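/- Let g : S × S → Bool be any function assigning to each encoder transition one of its output bits (so that the coded bit at time t is z_t = g(S_{t−1}, S_t)). Define the serial decision ẑ_t = 0 if P(g(S_{t−1}, S_t) = 0 | Y = y) ≥ 1/2 and ẑ_t = 1 otherwise, and the parallel decision ẑ_t^{i(t)} = 0 if P(g(S_{t−1}, S_t) = 0 | Y_{i(t)} = y|_{i(t)}) ≥ 1/2 and ẑ_t^{i(t)} = 1 otherwise. Then for every t ∈ {1,…,L} and every observation sequence y with P(Y = y) > 0, the serial and parallel decisions for the coded bits coincide: ẑ_t = ẑ_t^{i(t)}. -/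

import Mathlib

/-!
Finite hidden Markov source over a memoryless channel.
States `S` (with distinguished state `0`), channel output symbols `O`.
A state path is `s : Fin (L+1) → S`; an observation sequence is `y : Fin L → O`,
where index `t : Fin L` represents time `t+1 ∈ {1,…,L}`.
-/

open scoped Classical in
/-- The probability of an event `A` under the mass function `P`. -/
noncomputable def prob {S O : Type*} [Fintype S] [Fintype O] {L : ℕ}
    (P : (Fin (L + 1) → S) × (Fin L → O) → ℝ)
    (A : (Fin (L + 1) → S) × (Fin L → O) → Prop) : ℝ :=
  ∑ sy : (Fin (L + 1) → S) × (Fin L → O), if A sy then P sy else 0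

/-- The conditional probability `P(A | B)`. -/
noncomputable def condProb {S O : Type*} [Fintype S] [Fintype O] {L : ℕ}
    (P : (Fin (L + 1) → S) × (Fin L → O) → ℝ)
    (A B : (Fin (L + 1) → S) × (Fin L → O) → Prop) : ℝ :=
  prob P (fun sy => A sy ∧ B sy) / prob P B

/-- The realization which follows `x'` on the segment of times `a, …, b` and `x` elsewhere. -/
def splice {S O : Type*} {L : ℕ} (a b : ℕ) (x x' : (Fin (L + 1) → S) × (Fin L → O)) :
    (Fin (L + 1) → S) × (Fin L → O) :=
  (fun j => if a ≤ (j : ℕ) ∧ (j : ℕ) ≤ b then x'.1 j else x.1 j,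
    fun k => if a < (k : ℕ) + 1 ∧ (k : ℕ) + 1 ≤ b then x'.2 k else x.2 k)

lemma splice_splice {S O : Type*} {L : ℕ} (a b : ℕ)
    (x x' : (Fin (L + 1) → S) × (Fin L → O)) :
    splice a b (splice a b x x') (splice a b x' x) = x := by
  ext j <;> simp only [splice] <;> split_ifs <;> rfl

/-- Exchanging the segment of times `a, …, b` between two realizations. -/
def exchangeSegment {S O : Type*} {L : ℕ} (a b : ℕ) :
    Equiv.Perm (((Fin (L + 1) → S) × (Fin L → O)) × ((Fin (L + 1) → S) × (Fin L → O))) :=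
  Function.Involutive.toPerm (fun z => (splice a b z.1 z.2, splice a b z.2 z.1))
    fun z => Prod.ext (splice_splice a b z.1 z.2) (splice_splice a b z.2 z.1)

lemma prob_mono {S O : Type*} [Fintype S] [Fintype O] {L : ℕ}
    {P : (Fin (L + 1) → S) × (Fin L → O) → ℝ} (hP : ∀ x, 0 ≤ P x)
    {A B : (Fin (L + 1) → S) × (Fin L → O) → Prop} (hAB : ∀ x, A x → B x) :
    prob P A ≤ prob P B := by
  refine Finset.sum_le_sum fun x _ => ?_
  by_cases hA : A x
  · simp [hA, hAB x hA]
  · simp only [hA, if_false]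
    split_ifs <;> simp [hP]

/-- A measure-preserving permutation of pairs of realizations relates products of
probabilities. -/
lemma prob_mul_prob_eq_of_perm {S O : Type*} [Fintype S] [Fintype O] {L : ℕ}
    {P : (Fin (L + 1) → S) × (Fin L → O) → ℝ}
    (e : Equiv.Perm (((Fin (L + 1) → S) × (Fin L → O)) × ((Fin (L + 1) → S) × (Fin L → O))))
    (he : ∀ z, P z.1 * P z.2 = P (e z).1 * P (e z).2)
    {A B C D : (Fin (L + 1) → S) × (Fin L → O) → Prop}
    (h : ∀ z, A z.1 ∧ B z.2 ↔ C (e z).1 ∧ D (e z).2) :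
    prob P A * prob P B = prob P C * prob P D := by
  classical
  simp only [prob, Fintype.sum_mul_sum, ← Fintype.sum_prod_type']
  refine Fintype.sum_equiv e _ _ fun z => ?_
  simp only [ite_zero_mul_ite_zero, h z, he z]

/-- Exchanging a segment between two paths that agree at its end points preserves the product
of their weights. -/
lemma mul_eq_splice_mul_splice {S O : Type*} [Zero S] [DecidableEq S] {L : ℕ}
    {p : S → S → ℝ} {q : O → S → S → ℝ} {P : (Fin (L + 1) → S) × (Fin L → O) → ℝ}
    (hP : ∀ s y, P (s, y) =
      (if s 0 = 0 then (1 : ℝ) else 0) *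
        ∏ t : Fin L, p (s t.castSucc) (s t.succ) * q (y t) (s t.castSucc) (s t.succ))
    {a b : Fin (L + 1)} {x x' : (Fin (L + 1) → S) × (Fin L → O)}
    (ha : x.1 a = x'.1 a) (hb : x.1 b = x'.1 b) :
    P x * P x' = P (splice a b x x') * P (splice a b x' x) := by
  obtain ⟨s, y⟩ := x
  obtain ⟨s', y'⟩ := x'
  simp only [splice, hP]
  refine (mul_mul_mul_comm _ _ _ _).trans (Eq.trans ?_ (mul_mul_mul_comm _ _ _ _))
  rw [← Finset.prod_mul_distrib, ← Finset.prod_mul_distrib]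
  congr 1
  · split_ifs <;> simp
  refine Finset.prod_congr rfl fun k _ => ?_
  by_cases hk : (a : ℕ) < (k : ℕ) + 1 ∧ (k : ℕ) + 1 ≤ (b : ℕ)
  · have h₀ : (a : ℕ) ≤ k ∧ (k : ℕ) ≤ b := by omega
    have h₁ : (a : ℕ) ≤ (k : ℕ) + 1 ∧ (k : ℕ) + 1 ≤ b := by omega
    simp only [Fin.val_castSucc, Fin.val_succ, hk, h₀, h₁, and_self, if_true]
    ring
  · have h₀ : (a : ℕ) ≤ k ∧ (k : ℕ) ≤ b → s k.castSucc = s' k.castSucc := by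
      intro h
      rwa [show k.castSucc = b from Fin.ext (by simp only [Fin.val_castSucc]; omega)]
    have h₁ : (a : ℕ) ≤ (k : ℕ) + 1 ∧ (k : ℕ) + 1 ≤ b → s k.succ = s' k.succ := by
      intro h
      rwa [show k.succ = a from Fin.ext (by simp only [Fin.val_succ]; omega)]
    simp only [Fin.val_castSucc, Fin.val_succ, hk, if_false]
    congr 1 <;> split_ifs <;> simp_all

/-- **Serial and parallel decisions for the coded bits coincide.**
The decision is `false` (the bit 0) if the a-posteriori probability of the coded
bit being 0 is at least 1/2, and `true` (the bit 1) otherwise. -/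
theorem serial_parallel_decision_coded_bits
    {S O : Type*} [Fintype S] [Fintype O] [Nonempty S] [Nonempty O]
    [Zero S] [DecidableEq S]
    {N L : ℕ} (hN : 1 ≤ N) (hL : 1 ≤ L)
    -- boundary times 0 = L_0 < L_1 < ⋯ < L_N = L
    (Lb : Fin (N + 1) → Fin (L + 1)) (hmono : StrictMono Lb)
    (hLb0 : Lb 0 = 0) (hLbN : Lb (Fin.last N) = Fin.last L)
    -- the factorizing probability mass function
    (p : S → S → ℝ) (q : O → S → S → ℝ)
    (hp : ∀ a b, 0 ≤ p a b) (hq : ∀ o a b, 0 ≤ q o a b)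
    (P : (Fin (L + 1) → S) × (Fin L → O) → ℝ)
    (hP : ∀ s y, P (s, y) =
      (if s 0 = 0 then (1 : ℝ) else 0) *
        ∏ t : Fin L, p (s t.castSucc) (s t.succ) * q (y t) (s t.castSucc) (s t.succ))
    (hsum : ∑ sy : (Fin (L + 1) → S) × (Fin L → O), P sy = 1)
    -- termination: each parallel codeword drives the encoder back to state 0
    (hterm : ∀ s y, P (s, y) ≠ 0 → ∀ i : Fin (N + 1), s (Lb i) = 0)
    -- the output-bit map
    (g : S → S → Bool)
    -- the observation sequence, with positive serial probability
    (y : Fin L → O)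
    (hy : 0 < prob P (fun sy => sy.2 = y))
    -- the time t (as an element of Fin L, representing time t+1) and its segment index
    (t : Fin L) (i : Fin N)
    (hti : ((Lb i.castSucc : ℕ) < (t : ℕ) + 1) ∧ ((t : ℕ) + 1 ≤ (Lb i.succ : ℕ))) :
    (if (1 : ℝ) / 2 ≤
        condProb P (fun sy => g (sy.1 t.castSucc) (sy.1 t.succ) = false) (fun sy => sy.2 = y)
      then false else true) =
    (if (1 : ℝ) / 2 ≤
        condProb P (fun sy => g (sy.1 t.castSucc) (sy.1 t.succ) = false)
          (fun sy => ∀ k : Fin L,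
          (Lb i.castSucc : ℕ) < (k : ℕ) + 1 → (k : ℕ) + 1 ≤ (Lb i.succ : ℕ) →
            sy.2 k = y k)
      then false else true) := by
  have hP0 : ∀ x, 0 ≤ P x := fun ⟨s, z⟩ => by
    rw [hP]
    exact mul_nonneg (by split_ifs <;> simp)
      (Finset.prod_nonneg fun k _ => mul_nonneg (hp _ _) (hq _ _ _))
  set a := Lb i.castSucc
  set b := Lb i.succ
  have hagree : ∀ x x' : (Fin (L + 1) → S) × (Fin L → O), P x * P x' ≠ 0 →
      P x * P x' = P (splice a b x x') * P (splice a b x' x) := fun x x' h => by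
    have hx := hterm x.1 x.2 (left_ne_zero_of_mul h)
    have hx' := hterm x'.1 x'.2 (right_ne_zero_of_mul h)
    exact mul_eq_splice_mul_splice hP (by rw [hx, hx']) (by rw [hx, hx'])
  have hexch : ∀ x x' : (Fin (L + 1) → S) × (Fin L → O),
      P x * P x' = P (splice a b x x') * P (splice a b x' x) := fun x x' => by
    by_cases h : P x * P x' = 0
    · by_contra hne
      have h' := hagree (splice a b x x') (splice a b x' x) fun h0 => hne (h.trans h0.symm)
      rw [splice_splice, splice_splice] at h'
      exact hne h'.symm
    · exact hagree x x' h
  have hcross := prob_mul_prob_eq_of_perm (exchangeSegment (a : ℕ) (b : ℕ))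
    (fun z => hexch z.1 z.2)
    (A := fun sy => g (sy.1 t.castSucc) (sy.1 t.succ) = false ∧ sy.2 = y)
    (B := fun sy => ∀ k : Fin L, (a : ℕ) < (k : ℕ) + 1 → (k : ℕ) + 1 ≤ (b : ℕ) → sy.2 k = y k)
    (C := fun sy => sy.2 = y)
    (D := fun sy => g (sy.1 t.castSucc) (sy.1 t.succ) = false ∧
      ∀ k : Fin L, (a : ℕ) < (k : ℕ) + 1 → (k : ℕ) + 1 ≤ (b : ℕ) → sy.2 k = y k) (by
    rintro ⟨x, x'⟩
    have h₀ : (a : ℕ) ≤ t ∧ (t : ℕ) ≤ b := by omega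
    have h₁ : (a : ℕ) ≤ (t : ℕ) + 1 ∧ (t : ℕ) + 1 ≤ b := by omega
    simp only [exchangeSegment, Function.Involutive.coe_toPerm, splice, Fin.val_castSucc,
      Fin.val_succ, h₀, h₁, and_self, if_true, funext_iff]
    constructor
    · rintro ⟨⟨hg, hx⟩, hx'⟩
      refine ⟨fun k => ?_, hg, fun k h h' => ?_⟩
      · split_ifs with h
        exacts [hx' k h.1 h.2, hx k]
      · rw [if_pos ⟨h, h'⟩, hx]
    · rintro ⟨hx, hg, hx'⟩
      refine ⟨⟨hg, fun k => ?_⟩, fun k h h' => ?_⟩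
      · by_cases h : (a : ℕ) < (k : ℕ) + 1 ∧ (k : ℕ) + 1 ≤ (b : ℕ)
        · simpa only [h, and_self, if_true] using hx' k h.1 h.2
        · simpa only [h, if_false] using hx k
      · simpa only [h, h', and_self, if_true] using hx k)
  have hB : 0 < prob P (fun sy => ∀ k : Fin L,
      (a : ℕ) < (k : ℕ) + 1 → (k : ℕ) + 1 ≤ (b : ℕ) → sy.2 k = y k) :=
    hy.trans_le (prob_mono hP0 fun x hx k _ _ => by rw [hx])
  have hcond : condProb P (fun sy => g (sy.1 t.castSucc) (sy.1 t.succ) = false)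
      (fun sy => sy.2 = y) =
      condProb P (fun sy => g (sy.1 t.castSucc) (sy.1 t.succ) = false)
        (fun sy => ∀ k : Fin L,
          (a : ℕ) < (k : ℕ) + 1 → (k : ℕ) + 1 ≤ (b : ℕ) → sy.2 k = y k) := by
    rw [condProb, condProb, div_eq_div_iff hy.ne' hB.ne', hcross, mul_comm]
  rw [hcond]
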